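/- For any exponent q < 2 there is a constant C(q) such that for every smooth compactly supported vector field Z on ℝ³, ‖Z‖_{H¹_{2-q}(ℝ³)} ≤ C(q) ‖D(Z)‖_{L²_{3-q}(ℝ³)}, where D(Z)_{ij} = ∂_i Z_j + ∂_j Z_i is the Killing (deformation) operator of the Euclidean metric. -/

import Mathlib

open MeasureTheory Filter
open scoped BigOperators Topology RealInnerProductSpace

noncomputable section

abbrev E3 : Type := EuclideanSpace ℝ (Fin 3)

/-- Partial derivative in the `i`-th coordinate direction. -/
noncomputable def pd (i : Fin 3) (f : E3 → ℝ) (x : E3) : ℝ :=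
  fderiv ℝ f x (EuclideanSpace.single i 1)

/-- Euclidean Laplacian on `ℝ³`. -/
noncomputable def lap (f : E3 → ℝ) (x : E3) : ℝ :=
  ∑ i : Fin 3, pd i (pd i f) x


/-- `f` is differentiable at `x`, with `i`-th partial derivative `v`. -/
structure HP (i : Fin 3) (f : E3 → ℝ) (v : ℝ) (x : E3) : Prop where
  diff : DifferentiableAt ℝ f x
  eq : pd i f x = v

lemma HP.add {i f v g v' x} (hf : HP i f v x) (hg : HP i g v' x) :
    HP i (fun y => f y + g y) (v + v') x :=
  ⟨hf.diff.add hg.diff, by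
    rw [← hf.eq, ← hg.eq]; unfold pd
    rw [fderiv_fun_add hf.diff hg.diff]; rfl⟩

lemma HP.sub {i f v g v' x} (hf : HP i f v x) (hg : HP i g v' x) :
    HP i (fun y => f y - g y) (v - v') x :=
  ⟨hf.diff.sub hg.diff, by
    rw [← hf.eq, ← hg.eq]; unfold pd
    rw [fderiv_fun_sub hf.diff hg.diff]; rfl⟩

lemma HP.mul {i f v g v' x} (hf : HP i f v x) (hg : HP i g v' x) :
    HP i (fun y => f y * g y) (f x * v' + g x * v) x :=
  ⟨hf.diff.mul hg.diff, by
    rw [← hf.eq, ← hg.eq]; unfold pd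
    rw [fderiv_fun_mul hf.diff hg.diff]; simp⟩

lemma HP.const (i : Fin 3) (c : ℝ) (x : E3) : HP i (fun _ => c) 0 x :=
  ⟨differentiableAt_const c, by unfold pd; simp⟩

lemma HP.coord (i j : Fin 3) (x : E3) : HP i (fun y => y j) (if i = j then 1 else 0) x := by
  have h : HasFDerivAt (fun y : E3 => y j) (EuclideanSpace.proj j : E3 →L[ℝ] ℝ) x :=
    (EuclideanSpace.proj j : E3 →L[ℝ] ℝ).hasFDerivAt
  refine ⟨h.differentiableAt, ?_⟩
  unfold pd
  rw [h.fderiv]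
  simp [eq_comm]

lemma HP.of_contDiff {f : E3 → ℝ} (hf : ContDiff ℝ 1 f) (i : Fin 3) (x : E3) :
    HP i f (pd i f x) x :=
  ⟨hf.differentiable (by norm_num) x, rfl⟩

/-- The smooth weight `1 + |x|²`. -/
def wt (x : E3) : ℝ := 1 + (x 0 * x 0 + x 1 * x 1 + x 2 * x 2)

lemma wt_pos (x : E3) : 0 < wt x := by unfold wt; nlinarith [mul_self_nonneg (x 0), mul_self_nonneg (x 1), mul_self_nonneg (x 2)]

lemma wt_eq (x : E3) : wt x = 1 + ‖x‖ ^ 2 := by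
  rw [EuclideanSpace.norm_sq_eq, Fin.sum_univ_three]
  simp only [wt, Real.norm_eq_abs, sq_abs]; ring

lemma coord_contDiff (j : Fin 3) {n} : ContDiff ℝ n (fun y : E3 => y j) :=
  (EuclideanSpace.proj j : E3 →L[ℝ] ℝ).contDiff

lemma wt_contDiff {n} : ContDiff ℝ n wt := by
  unfold wt
  have := fun j => coord_contDiff j (n := n)
  fun_prop (disch := assumption)

lemma wtp_contDiff {n} (s : ℝ) : ContDiff ℝ n (fun x => wt x ^ s) :=
  wt_contDiff.rpow_const_of_ne fun x => (wt_pos x).ne'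

lemma HP.wt (i : Fin 3) (x : E3) : HP i wt (2 * x i) x := by
  have h := ((HP.const i 1 x).add ((((HP.coord i 0 x).mul (HP.coord i 0 x)).add
    ((HP.coord i 1 x).mul (HP.coord i 1 x))).add ((HP.coord i 2 x).mul (HP.coord i 2 x))))
  refine ⟨h.diff, h.eq.trans ?_⟩
  fin_cases i <;> simp <;> ring

lemma HP.wtp (s : ℝ) (i : Fin 3) (x : E3) :
    HP i (fun y => _root_.wt y ^ s) (2 * s * _root_.wt x ^ (s - 1) * x i) x := by
  have h := (HP.wt i x)
  have h2 := h.diff.hasFDerivAt.rpow_const (p := s) (Or.inl (wt_pos x).ne')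
  refine ⟨h2.differentiableAt, ?_⟩
  have h3 := h.eq
  unfold pd at h3 ⊢
  rw [h2.fderiv]
  simp only [smul_apply, h3, smul_eq_mul]; ring

lemma integral_pd_eq_zero (i : Fin 3) {F : E3 → ℝ} (hF : ContDiff ℝ 1 F)
    (hc : HasCompactSupport F) : ∫ x, pd i F x = 0 := by
  have hd : Continuous (fun x => pd i F x) :=
    (hF.continuous_fderiv (by norm_num)).clm_apply continuous_const
  have hcd : HasCompactSupport (fun x => pd i F x) := hc.fderiv_apply (𝕜 := ℝ) _
  have := integral_mul_fderiv_eq_neg_fderiv_mul_of_integrable (μ := (volume : Measure E3))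
    (f := fun _ => (1:ℝ)) (g := F) (v := EuclideanSpace.single i 1) (by simp)
    (by simpa [pd] using hd.integrable_of_hasCompactSupport hcd)
    (by simpa using hF.continuous.integrable_of_hasCompactSupport hc)
    (by fun_prop) (fun x _ => hF.differentiable (by norm_num) x)
  simpa [pd] using this

lemma pd_contDiff {f : E3 → ℝ} (hf : ContDiff ℝ (⊤ : ℕ∞) f) (i : Fin 3) :
    ContDiff ℝ (⊤ : ℕ∞) (pd i f) := by
  unfold pd
  exact (hf.fderiv_right (m := (⊤ : ℕ∞)) (by simp)).clm_apply contDiff_const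

lemma pd_comm {f : E3 → ℝ} (hf : ContDiff ℝ (⊤ : ℕ∞) f) (i j : Fin 3) (x : E3) :
    pd i (pd j f) x = pd j (pd i f) x := by
  have hs : IsSymmSndFDerivAt ℝ f x :=
    hf.contDiffAt.isSymmSndFDerivAt (by
      rw [minSmoothness_of_isRCLikeNormedField]
      exact WithTop.coe_le_coe.2 (le_top : (2 : ℕ∞) ≤ ⊤))
  have hd : DifferentiableAt ℝ (fderiv ℝ f) x :=
    ((hf.fderiv_right (m := (⊤ : ℕ∞)) (by simp)).differentiable (by simp)) x
  have key : ∀ a b : Fin 3, pd a (pd b f) x =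
      fderiv ℝ (fderiv ℝ f) x (EuclideanSpace.single a 1) (EuclideanSpace.single b 1) := by
    intro a b
    unfold pd
    rw [fderiv_clm_apply hd (by fun_prop)]
    simp
  rw [key, key]; exact hs _ _

lemma alg1 {c m P w S u T d : ℝ} (hc : 0 < c) (hc5 : c ≤ 5) (hcm : c ≤ 2 * m + 1) (hP : 0 < P)
    (hS : 0 ≤ S) (hw : w = 1 + S) (hd : 0 ≤ d) (hT : T ^ 2 ≤ d * S ^ 2) :
    c / 2 * (u ^ 2 * (P * w)) ≤
      P * w * (5 * u ^ 2 + u * T) + 2 * (m - 2) * S * P * u ^ 2 + 1 / (2 * c) * (d * (P * w ^ 3)) := by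
  have hw0 : 0 < w := by linarith
  have h1 : c * w ≤ 5 * w + 2 * (m - 2) * S := by rw [hw]; nlinarith
  have hT' : T ^ 2 ≤ d * w ^ 2 := hT.trans (by gcongr; linarith)
  have h2 : 0 ≤ u * T + 1 / (2 * c) * (d * w ^ 2) + c / 2 * u ^ 2 := by
    have : 0 ≤ (1 / (2 * c)) * ((c * u + T) ^ 2 + (d * w ^ 2 - T ^ 2)) := by
      have := sq_nonneg (c * u + T)
      have : 0 ≤ d * w ^ 2 - T ^ 2 := by linarith
      positivity
    have e : (1 / (2 * c)) * ((c * u + T) ^ 2 + (d * w ^ 2 - T ^ 2)) =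
      u * T + 1 / (2 * c) * (d * w ^ 2) + c / 2 * u ^ 2 := by field_simp; ring
    linarith
  have h3 := mul_nonneg (mul_nonneg hP.le hw0.le) h2
  have h4 := mul_nonneg (mul_nonneg hP.le (sq_nonneg u)) (sub_nonneg.2 h1)
  nlinarith

lemma alg2 {m P w S u Q e d z : ℝ} (hm : -(1 / 2) < m) (hP : 0 < P)
    (hS : 0 ≤ S) (hw : w = 1 + S) (hd : 0 ≤ d) (hz : 0 ≤ z)
    (hQ : Q ^ 2 ≤ z * (d * S)) (he : e ^ 2 ≤ d) :
    1 / 2 * (z * (P * w ^ 2)) ≤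
      (P * w ^ 2 * (Q + 5 / 2 * z) + (m - 1) * S * (P * w) * z
        + P * w ^ 2 * (u * e) + 2 * (m - 1) * (P * w) * u ^ 2)
       + d * (P * w ^ 3) + 4 * (u ^ 2 * (P * w)) := by
  have hw0 : 0 < w := by linarith
  have h1 : w ≤ 5 / 2 * w + (m - 1) * S := by rw [hw]; nlinarith
  have h2 : 0 ≤ Q + 1 / 2 * z + 1 / 2 * (d * w) := by
    have hdw : d * S ≤ d * w := by gcongr; linarith
    have : Q ^ 2 ≤ (1 / 2 * z + 1 / 2 * (d * w)) ^ 2 := by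
      have := mul_le_mul_of_nonneg_left hdw hz
      nlinarith [sq_nonneg (z - d * w)]
    have := abs_le_of_sq_le_sq this (by positivity)
    linarith [neg_abs_le Q]
  have h3 : 0 ≤ w * (u * e) + 1 / 2 * u ^ 2 + 1 / 2 * (d * w ^ 2) := by
    nlinarith [sq_nonneg (u + w * e), mul_le_mul_of_nonneg_right he (sq_nonneg w)]
  have h5 : 0 ≤ (2 * (m - 1) + 3) * u ^ 2 := by
    apply mul_nonneg _ (sq_nonneg u); linarith
  have hPw : 0 < P * w := mul_pos hP hw0
  have h6 := mul_nonneg (mul_nonneg hPw.le hz) (sub_nonneg.2 h1)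
  have h7 := mul_nonneg (mul_nonneg hPw.le hw0.le) h2
  have h8 := mul_nonneg hPw.le h3
  have h9 := mul_nonneg hPw.le h5
  have h10 := mul_nonneg hPw.le (sq_nonneg u)
  nlinarith

lemma alg3 {m P w S R v e d z G N : ℝ} (hP : 0 < P)
    (hS : 0 ≤ S) (hw : w = 1 + S) (hG : 0 ≤ G) (hz : 0 ≤ z)
    (hdN : d = 2 * G + 2 * N)
    (hR : R ^ 2 ≤ S * z * G) (hv : v ^ 2 ≤ S * z) :
    G * (P * w ^ 3) ≤ d * (P * w ^ 3) + (6 * m ^ 2) * (z * (P * w ^ 2))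
      - 2 * (P * w ^ 3 * (N - e ^ 2) + 2 * m * (P * w ^ 2) * (R - v * e)) := by
  have hw0 : 0 < w := by linarith
  have h1 : 0 ≤ w * G + 4 * m ^ 2 * z - 4 * m * R := by
    have : (4 * m * R) ^ 2 ≤ (w * G + 4 * m ^ 2 * z) ^ 2 := by
      have h0 : S * z * G ≤ w * z * G := by gcongr; linarith
      have := mul_le_mul_of_nonneg_left (hR.trans h0) (sq_nonneg (4 * m))
      nlinarith [sq_nonneg (w * G - 4 * m ^ 2 * z)]
    have := abs_le_of_sq_le_sq this (by positivity)
    linarith [le_abs_self (4 * m * R)]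
  have h2 : 0 ≤ 2 * m ^ 2 * z + 4 * m * v * e + 2 * w * e ^ 2 := by
    have h0 : v ^ 2 ≤ w * z := hv.trans (by gcongr; linarith)
    have : 0 ≤ w * (2 * m ^ 2 * z + 4 * m * v * e + 2 * w * e ^ 2) := by
      nlinarith [sq_nonneg (m * v + w * e), mul_le_mul_of_nonneg_left h0 (sq_nonneg m)]
    exact nonneg_of_mul_nonneg_right this hw0
  have hPw : 0 ≤ P * w ^ 2 := by positivity
  have h3 := mul_nonneg hPw h1
  have h4 := mul_nonneg hPw h2
  subst hdN
  nlinarith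

lemma cs3 (a b : Fin 3 → ℝ) : (∑ i, a i * b i) ^ 2 ≤ (∑ i, a i ^ 2) * ∑ i, b i ^ 2 :=
  Finset.sum_mul_sq_le_sq_mul_sq _ _ _

/-- bilinear form bound -/
lemma cs33 (a b : Fin 3 → ℝ) (g : Fin 3 → Fin 3 → ℝ) :
    (∑ i, a i * ∑ j, g i j * b j) ^ 2 ≤
      (∑ i, a i ^ 2) * ((∑ i, ∑ j, g i j ^ 2) * ∑ j, b j ^ 2) := by
  refine (cs3 _ _).trans ?_
  gcongr
  rw [Finset.sum_mul]
  exact Finset.sum_le_sum fun i _ => cs3 _ _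

section fields
variable (Z : Fin 3 → E3 → ℝ)

/-- Radial component `Z · x`. -/
def uu (x : E3) : ℝ := Z 0 x * x 0 + Z 1 x * x 1 + Z 2 x * x 2

def sx (x : E3) : ℝ := ∑ i, (x i) ^ 2
lemma wt_sx (x : E3) : wt x = 1 + sx x := by
  unfold wt sx; rw [Fin.sum_univ_three]; ring

def z2 (x : E3) : ℝ := ∑ j : Fin 3, (Z j x) ^ 2
def g2 (x : E3) : ℝ := ∑ i : Fin 3, ∑ j : Fin 3, (pd i (Z j) x) ^ 2
def d2 (x : E3) : ℝ := ∑ i : Fin 3, ∑ j : Fin 3, (pd i (Z j) x + pd j (Z i) x) ^ 2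

def F1 (m : ℝ) (i : Fin 3) (x : E3) : ℝ := uu Z x * uu Z x * (x i * wt x ^ (m - 2))
def F2 (m : ℝ) (i : Fin 3) (x : E3) : ℝ :=
  (1 / 2 * (Z 0 x * Z 0 x + Z 1 x * Z 1 x + Z 2 x * Z 2 x) * x i + Z i x * uu Z x) * wt x ^ (m - 1)
def F3 (m : ℝ) (i : Fin 3) (x : E3) : ℝ :=
  ((Z 0 x * pd 0 (Z i) x + Z 1 x * pd 1 (Z i) x + Z 2 x * pd 2 (Z i) x)
    - Z i x * (pd 0 (Z 0) x + pd 1 (Z 1) x + pd 2 (Z 2) x)) * wt x ^ m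

variable {Z}

lemma HP.fld (hZ : ∀ j, ContDiff ℝ (⊤ : ℕ∞) (Z j)) (x : E3)
    (i j : Fin 3) : HP i (Z j) (pd i (Z j) x) x :=
  HP.of_contDiff ((hZ j).of_le (by exact_mod_cast le_top)) i x

lemma HP.pdZ (hZ : ∀ j, ContDiff ℝ (⊤ : ℕ∞) (Z j)) (x : E3)
    (i k j : Fin 3) : HP i (pd k (Z j)) (pd i (pd k (Z j)) x) x :=
  HP.of_contDiff ((pd_contDiff (hZ j) k).of_le (by exact_mod_cast le_top)) i x

lemma HP.uu (hZ : ∀ j, ContDiff ℝ (⊤ : ℕ∞) (Z j)) (x : E3)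
    (i : Fin 3) :
    HP i (uu Z) (pd i (Z 0) x * x 0 + pd i (Z 1) x * x 1 + pd i (Z 2) x * x 2 + Z i x) x := by
  have h := (((HP.fld hZ x i 0).mul (HP.coord i 0 x)).add ((HP.fld hZ x i 1).mul (HP.coord i 1 x))).add
    ((HP.fld hZ x i 2).mul (HP.coord i 2 x))
  refine ⟨h.diff, h.eq.trans ?_⟩
  fin_cases i <;> simp <;> ring

lemma pw1 (hZ : ∀ j, ContDiff ℝ (⊤ : ℕ∞) (Z j)) (m : ℝ) (x : E3)
    {c : ℝ} (hc : 0 < c) (hc5 : c ≤ 5) (hcm : c ≤ 2 * m + 1) :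
    c / 2 * (uu Z x ^ 2 * wt x ^ (m - 2)) ≤ ∑ i, pd i (F1 Z m i) x
      + 1 / (2 * c) * (d2 Z x * wt x ^ m) := by
  have hw := wt_pos x
  have e2 : wt x ^ (m - 2) = wt x ^ (m - 3) * wt x := by
    rw [← Real.rpow_add_one hw.ne']; ring_nf
  have e0 : wt x ^ m = wt x ^ (m - 3) * wt x ^ 3 := by
    rw [← Real.rpow_natCast, ← Real.rpow_add hw]; norm_num
  have hd : ∑ i, pd i (F1 Z m i) x = wt x ^ (m - 3) * wt x * (5 * uu Z x ^ 2
      + uu Z x * (∑ i, x i * ∑ j, (pd i (Z j) x + pd j (Z i) x) * x j))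
      + 2 * (m - 2) * sx x * wt x ^ (m - 3) * uu Z x ^ 2 := by
    have h : ∀ i, _ := fun i => (((HP.uu hZ x i).mul (HP.uu hZ x i)).mul
      ((HP.coord i i x).mul (HP.wtp (m - 2) i x))).eq
    unfold F1
    simp only [h, Fin.sum_univ_three, sx, e2, show m - 2 - 1 = m - 3 by ring, if_true]
    simp only [_root_.uu]
    ring
  rw [hd, e2, e0]
  refine alg1 hc hc5 hcm (Real.rpow_pos_of_pos hw _) ?_ (wt_sx x) ?_ ?_
  · unfold sx; positivity
  · unfold d2; positivity
  · refine (cs33 _ _ _).trans (le_of_eq ?_)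
    unfold d2 sx; ring

lemma pw2 (hZ : ∀ j, ContDiff ℝ (⊤ : ℕ∞) (Z j)) (m : ℝ) (x : E3)
    (hm : -(1 / 2) < m) :
    1 / 2 * (z2 Z x * wt x ^ (m - 1)) ≤ ∑ i, pd i (F2 Z m i) x
      + d2 Z x * wt x ^ m + 4 * (uu Z x ^ 2 * wt x ^ (m - 2)) := by
  have hw := wt_pos x
  have e2 : wt x ^ (m - 2) = wt x ^ (m - 3) * wt x := by
    rw [← Real.rpow_add_one hw.ne']; ring_nf
  have e1 : wt x ^ (m - 1) = wt x ^ (m - 3) * wt x ^ 2 := by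
    rw [← Real.rpow_natCast, ← Real.rpow_add hw]; norm_num; ring_nf
  have e0 : wt x ^ m = wt x ^ (m - 3) * wt x ^ 3 := by
    rw [← Real.rpow_natCast, ← Real.rpow_add hw]; norm_num
  have hd : ∑ i, pd i (F2 Z m i) x = wt x ^ (m - 3) * wt x ^ 2 *
        ((∑ i, Z i x * ∑ j, (pd i (Z j) x + pd j (Z i) x) * x j) + 5 / 2 * z2 Z x)
      + (m - 1) * sx x * (wt x ^ (m - 3) * wt x) * z2 Z x
      + wt x ^ (m - 3) * wt x ^ 2 * (uu Z x * (pd 0 (Z 0) x + pd 1 (Z 1) x + pd 2 (Z 2) x))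
      + 2 * (m - 1) * (wt x ^ (m - 3) * wt x) * uu Z x ^ 2 := by
    have h : ∀ i, _ := fun i => ((((((HP.const i (1 / 2) x).mul
      ((((HP.fld hZ x i 0).mul (HP.fld hZ x i 0)).add ((HP.fld hZ x i 1).mul (HP.fld hZ x i 1))).add
      ((HP.fld hZ x i 2).mul (HP.fld hZ x i 2)))).mul (HP.coord i i x)).add
      ((HP.fld hZ x i i).mul (HP.uu hZ x i))).mul (HP.wtp (m - 1) i x))).eq
    unfold F2
    simp only [h, Fin.sum_univ_three, sx, z2, e1, e2, show m - 1 - 1 = m - 2 by ring, if_true]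
    simp only [_root_.uu]
    ring
  rw [hd, e2, e1, e0]
  refine alg2 hm (Real.rpow_pos_of_pos hw _) ?_ (wt_sx x) ?_ ?_ ?_ ?_
  · unfold sx; positivity
  · unfold d2; positivity
  · unfold z2; positivity
  · exact cs33 _ _ _
  · unfold d2
    simp only [Fin.sum_univ_three]
    have := fun i j => sq_nonneg (pd i (Z j) x + pd j (Z i) x)
    nlinarith [this 0 1, this 0 2, this 1 2, this 1 0, this 2 0, this 2 1,
      sq_nonneg (pd 0 (Z 0) x - pd 1 (Z 1) x), sq_nonneg (pd 0 (Z 0) x - pd 2 (Z 2) x),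
      sq_nonneg (pd 1 (Z 1) x - pd 2 (Z 2) x), sq_nonneg (pd 0 (Z 0) x), sq_nonneg (pd 1 (Z 1) x),
      sq_nonneg (pd 2 (Z 2) x)]

lemma pw3 (hZ : ∀ j, ContDiff ℝ (⊤ : ℕ∞) (Z j)) (m : ℝ) (x : E3) :
    g2 Z x * wt x ^ m ≤ d2 Z x * wt x ^ m + (6 * m ^ 2) * (z2 Z x * wt x ^ (m - 1))
      - 2 * ∑ i, pd i (F3 Z m i) x := by
  have hw := wt_pos x
  have e1 : wt x ^ (m - 1) = wt x ^ (m - 3) * wt x ^ 2 := by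
    rw [← Real.rpow_natCast, ← Real.rpow_add hw]; norm_num; ring_nf
  have e0 : wt x ^ m = wt x ^ (m - 3) * wt x ^ 3 := by
    rw [← Real.rpow_natCast, ← Real.rpow_add hw]; norm_num
  have hd : ∑ i, pd i (F3 Z m i) x = wt x ^ (m - 3) * wt x ^ 3 *
        ((∑ i, ∑ j, pd i (Z j) x * pd j (Z i) x)
          - (pd 0 (Z 0) x + pd 1 (Z 1) x + pd 2 (Z 2) x) ^ 2)
      + 2 * m * (wt x ^ (m - 3) * wt x ^ 2) * ((∑ i, Z i x * ∑ j, pd i (Z j) x * x j)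
        - (∑ i, x i * Z i x) * (pd 0 (Z 0) x + pd 1 (Z 1) x + pd 2 (Z 2) x)) := by
    have h : ∀ i, _ := fun i => (((((((HP.fld hZ x i 0).mul (HP.pdZ hZ x i 0 i)).add
      ((HP.fld hZ x i 1).mul (HP.pdZ hZ x i 1 i))).add ((HP.fld hZ x i 2).mul (HP.pdZ hZ x i 2 i))).sub
      ((HP.fld hZ x i i).mul (((HP.pdZ hZ x i 0 0).add (HP.pdZ hZ x i 1 1)).add
        (HP.pdZ hZ x i 2 2)))).mul (HP.wtp m i x))).eq
    unfold F3
    simp only [h, Fin.sum_univ_three, e1, e0]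
    rw [pd_comm (hZ 0) 1 0, pd_comm (hZ 0) 2 0, pd_comm (hZ 1) 2 1, pd_comm (hZ 1) 1 0,
      pd_comm (hZ 2) 2 0, pd_comm (hZ 2) 2 1]
    ring
  rw [hd, e1, e0]
  refine alg3 (Real.rpow_pos_of_pos hw _) (S := sx x) ?_ (wt_sx x) ?_ ?_ ?_ ?_ ?_
  · unfold sx; positivity
  · unfold g2; positivity
  · unfold z2; positivity
  · unfold d2 g2; simp only [Fin.sum_univ_three]; ring
  · refine (cs33 _ _ _).trans (le_of_eq ?_)
    unfold z2 g2 sx; ring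
  · exact cs3 _ _

end fields

section integrals
variable {Z : Fin 3 → E3 → ℝ}

lemma cpt (hc : ∀ j, HasCompactSupport (Z j)) {f : E3 → ℝ}
    (h : ∀ x, (∀ j, Z j x = 0) → (∀ i j, pd i (Z j) x = 0) → f x = 0) : HasCompactSupport f := by
  refine HasCompactSupport.intro (K := ⋃ j, tsupport (Z j)) (isCompact_iUnion fun j => hc j) ?_
  intro x hx
  simp only [Set.mem_iUnion, not_exists] at hx
  refine h x (fun j => image_eq_zero_of_notMem_tsupport (hx j)) fun i j => ?_
  unfold pd
  have : fderiv ℝ (Z j) x = 0 := by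
    by_contra hne
    exact hx j (support_fderiv_subset ℝ hne)
  rw [this]; rfl

lemma integral_div_eq_zero {F : Fin 3 → E3 → ℝ} (hF : ∀ i, ContDiff ℝ 1 (F i))
    (hc : ∀ i, HasCompactSupport (F i)) :
    Integrable (fun x => ∑ i, pd i (F i) x) ∧ ∫ x, ∑ i, pd i (F i) x = 0 := by
  have hi : ∀ i, Integrable (fun x => pd i (F i) x) := fun i => by
    have hd : Continuous (fun x => pd i (F i) x) :=
      ((hF i).continuous_fderiv (by norm_num)).clm_apply continuous_const
    have hcd : HasCompactSupport (fun x => pd i (F i) x) := (hc i).fderiv_apply (𝕜 := ℝ) _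
    exact hd.integrable_of_hasCompactSupport hcd
  refine ⟨integrable_finsetSum _ fun i _ => hi i, ?_⟩
  rw [integral_finsetSum _ fun i _ => hi i]
  exact Finset.sum_eq_zero fun i _ => integral_pd_eq_zero i (hF i) (hc i)

lemma main_ineq (m : ℝ) (hm : -(1 / 2) < m) : ∃ C : ℝ, 0 ≤ C ∧ ∀ Z : Fin 3 → E3 → ℝ,
      (∀ j, ContDiff ℝ (⊤ : ℕ∞) (Z j)) → (∀ j, HasCompactSupport (Z j)) →
      (∫ x, z2 Z x * wt x ^ (m - 1)) ≤ C * ∫ x, d2 Z x * wt x ^ m ∧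
      (∫ x, g2 Z x * wt x ^ m) ≤ C * ∫ x, d2 Z x * wt x ^ m := by
  obtain ⟨c, hc0, hc5, hcm⟩ : ∃ c : ℝ, 0 < c ∧ c ≤ 5 ∧ c ≤ 2 * m + 1 :=
    ⟨min 5 (2 * m + 1), lt_min (by norm_num) (by linarith), min_le_left _ _, min_le_right _ _⟩
  set C1 : ℝ := 2 + 8 / c ^ 2 with hC1
  have hC1p : 0 ≤ C1 := by positivity
  refine ⟨1 + C1 + 6 * m ^ 2 * C1, by positivity, ?_⟩
  intro Z hZ hc
  have hZ1 : ∀ j, ContDiff ℝ 1 (Z j) := fun j => (hZ j).of_le (by exact_mod_cast le_top)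
  have hP1 : ∀ i j, ContDiff ℝ 1 (pd i (Z j)) := fun i j =>
    (pd_contDiff (hZ j) i).of_le (by exact_mod_cast le_top)
  have hco := fun j => coord_contDiff j (n := 1)
  have hwt := fun s => wtp_contDiff (n := 1) s
  have hu1 : ContDiff ℝ 1 (uu Z) := by
    unfold uu
    exact (((hZ1 0).mul (hco 0)).add ((hZ1 1).mul (hco 1))).add ((hZ1 2).mul (hco 2))
  obtain ⟨i1, j1⟩ := integral_div_eq_zero (F := F1 Z m)
    (fun i => (hu1.mul hu1).mul ((hco i).mul (hwt (m - 2))))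
    (fun i => cpt hc fun x h _ => by simp [F1, uu, h])
  obtain ⟨i2, j2⟩ := integral_div_eq_zero (F := F2 Z m)
    (fun i => (((contDiff_const.mul ((((hZ1 0).mul (hZ1 0)).add ((hZ1 1).mul (hZ1 1))).add
      ((hZ1 2).mul (hZ1 2)))).mul (hco i)).add ((hZ1 i).mul hu1)).mul (hwt (m - 1)))
    (fun i => cpt hc fun x h _ => by simp [F2, uu, h])
  obtain ⟨i3, j3⟩ := integral_div_eq_zero (F := F3 Z m)
    (fun i => (((((hZ1 0).mul (hP1 0 i)).add ((hZ1 1).mul (hP1 1 i))).add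
      ((hZ1 2).mul (hP1 2 i))).sub ((hZ1 i).mul (((hP1 0 0).add (hP1 1 1)).add (hP1 2 2)))).mul
      (hwt m))
    (fun i => cpt hc fun x h _ => by simp [F3, h])
  have cw := fun s => (hwt s).continuous
  have cZ := fun j => (hZ1 j).continuous
  have cP := fun i j => (hP1 i j).continuous
  have cu := hu1.continuous
  have iu : Integrable (fun x => uu Z x ^ 2 * wt x ^ (m - 2)) :=
    ((cu.pow 2).mul (cw _)).integrable_of_hasCompactSupport
      (cpt hc fun x h _ => by simp [uu, h])
  have iz : Integrable (fun x => z2 Z x * wt x ^ (m - 1)) :=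
    Continuous.integrable_of_hasCompactSupport
      ((continuous_finsetSum _ fun j _ => (cZ j).pow 2).mul (cw _))
      (cpt hc fun x h _ => by simp [z2, h])
  have ig : Integrable (fun x => g2 Z x * wt x ^ m) :=
    Continuous.integrable_of_hasCompactSupport
      ((continuous_finsetSum _ fun i _ => continuous_finsetSum _ fun j _ =>
        (cP i j).pow 2).mul (cw _))
      (cpt hc fun x _ h => by simp [g2, h])
  have idd : Integrable (fun x => d2 Z x * wt x ^ m) :=
    Continuous.integrable_of_hasCompactSupport
      ((continuous_finsetSum _ fun i _ => continuous_finsetSum _ fun j _ =>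
        ((cP i j).add (cP j i)).pow 2).mul (cw _))
      (cpt hc fun x _ h => by simp [d2, h])
  have I1 := integral_mono (iu.const_mul (c / 2)) (i1.add (idd.const_mul (1 / (2 * c))))
    (fun x => pw1 hZ m x hc0 hc5 hcm)
  have I2 := integral_mono (iz.const_mul (1 / 2)) ((i2.add idd).add (iu.const_mul 4))
    (fun x => pw2 hZ m x hm)
  have I3 := integral_mono ig ((idd.add (iz.const_mul (6 * m ^ 2))).sub (i3.const_mul 2))
    (fun x => pw3 hZ m x)
  rw [integral_add' i1 (idd.const_mul _), integral_const_mul, integral_const_mul, j1] at I1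
  rw [integral_add' (i2.add idd) (iu.const_mul _), integral_add' i2 idd, integral_const_mul,
    integral_const_mul, j2] at I2
  rw [integral_sub' (idd.add (iz.const_mul _)) (i3.const_mul 2),
    integral_add' idd (iz.const_mul _), integral_const_mul, integral_const_mul, j3] at I3
  have hD : 0 ≤ ∫ x, d2 Z x * wt x ^ m := integral_nonneg fun x => by
    have := wt_pos x
    simp only [d2, Pi.zero_apply]; positivity
  set D := ∫ x, d2 Z x * wt x ^ m
  set A := ∫ x, z2 Z x * wt x ^ (m - 1)
  set G := ∫ x, g2 Z x * wt x ^ m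
  set U := ∫ x, uu Z x ^ 2 * wt x ^ (m - 2)
  have hU : U ≤ 1 / c ^ 2 * D := by
    have := mul_le_mul_of_nonneg_left I1 (by positivity : 0 ≤ 2 / c)
    have e1 : 2 / c * (c / 2 * U) = U := by field_simp
    have e2 : 2 / c * (0 + 1 / (2 * c) * D) = 1 / c ^ 2 * D := by field_simp; ring
    linarith
  have hA : A ≤ C1 * D := by
    have : C1 * D = 2 * D + 8 * (1 / c ^ 2 * D) := by rw [hC1]; ring
    linarith
  have hmA := mul_le_mul_of_nonneg_left hA (by positivity : 0 ≤ 6 * m ^ 2)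
  have p1 := mul_nonneg hC1p hD
  have p2 := mul_nonneg (by positivity : 0 ≤ 6 * m ^ 2) p1
  constructor <;> nlinarith

lemma rpow_comp {a b : ℝ} (ha : 0 < a) (hab : a ≤ b) (hb : b ≤ 2 * a) (s : ℝ) :
    a ^ s ≤ 2 ^ |s| * b ^ s ∧ b ^ s ≤ 2 ^ |s| * a ^ s := by
  have hb0 : 0 < b := ha.trans_le hab
  have hK : (1 : ℝ) ≤ 2 ^ |s| := Real.one_le_rpow (by norm_num) (abs_nonneg s)
  have pa := Real.rpow_pos_of_pos ha s
  have pb := Real.rpow_pos_of_pos hb0 s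
  rcases le_total 0 s with hs | hs
  · have h1 := Real.rpow_le_rpow ha.le hab hs
    have h2 := Real.rpow_le_rpow hb0.le hb hs
    rw [Real.mul_rpow (by norm_num) ha.le] at h2
    rw [abs_of_nonneg hs] at hK ⊢
    exact ⟨by nlinarith, h2⟩
  · have h1 := Real.rpow_le_rpow_of_nonpos ha hab hs
    have h2 := Real.rpow_le_rpow_of_nonpos hb0 hb hs
    rw [Real.mul_rpow (by norm_num) ha.le] at h2
    rw [abs_of_nonpos hs] at hK ⊢
    refine ⟨?_, by nlinarith⟩
    have h3 : (2 : ℝ) ^ (-s) * 2 ^ s = 1 := by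
      rw [← Real.rpow_add (by norm_num)]; simp
    calc a ^ s = 2 ^ (-s) * (2 ^ s * a ^ s) := by rw [← mul_assoc, h3, one_mul]
      _ ≤ _ := by gcongr

lemma r_comp (x : E3) (s : ℝ) :
    (max ‖x‖ 1) ^ (2 * s) ≤ 2 ^ |s| * wt x ^ s ∧ wt x ^ s ≤ 2 ^ |s| * (max ‖x‖ 1) ^ (2 * s) := by
  have h1 : (1 : ℝ) ≤ max ‖x‖ 1 := le_max_right _ _
  have h0 : ‖x‖ ≤ max ‖x‖ 1 := le_max_left _ _
  have hn := norm_nonneg x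
  have e : (max ‖x‖ 1) ^ (2 * s) = ((max ‖x‖ 1) ^ 2) ^ s := by
    rw [Real.rpow_mul (by linarith)]; norm_num
  rw [e]
  refine rpow_comp (by positivity) ?_ ?_ s
  · rw [wt_eq]
    rcases max_cases ‖x‖ 1 with h | h <;> rw [h.1] <;> nlinarith
  · rw [wt_eq]; nlinarith

lemma int_comp {f p p' : E3 → ℝ} {K : ℝ} (hf : Continuous f) (hc : HasCompactSupport f)
    (hf0 : ∀ x, 0 ≤ f x) (hp : Continuous p) (hp' : Continuous p') (h : ∀ x, p x ≤ K * p' x) :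
    ∫ x, f x * p x ≤ K * ∫ x, f x * p' x := by
  rw [← integral_const_mul]
  refine integral_mono ((hf.mul hp).integrable_of_hasCompactSupport hc.mul_right)
    (((hf.mul hp').integrable_of_hasCompactSupport hc.mul_right).const_mul K) fun x => ?_
  have := mul_le_mul_of_nonneg_left (h x) (hf0 x)
  simp only
  linarith

end integrals

/-- weighted Korn-type inequality. For any `q < 2` there is `C(q)` such
that for every smooth compactly supported vector field `Z` on ℝ³,
`‖Z‖_{H¹_{2-q}} ≤ C(q) ‖D(Z)‖_{L²_{3-q}}` where `D(Z)_{ij} = ∂_i Z_j + ∂_j Z_i`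
and `r(x) = max(|x|,1)`. -/
theorem stmt10 (q : ℝ) (hq : q < 2) :
    ∃ C : ℝ, ∀ Z : Fin 3 → E3 → ℝ,
      (∀ j, ContDiff ℝ (⊤ : ℕ∞) (Z j)) → (∀ j, HasCompactSupport (Z j)) →
      (∫ x : E3, (∑ j : Fin 3, (Z j x) ^ 2) * (max ‖x‖ 1) ^ (-3 + 2 * (2 - q)))
        + (∫ x : E3, (∑ i : Fin 3, ∑ j : Fin 3, (pd i (Z j) x) ^ 2)
            * (max ‖x‖ 1) ^ (-1 + 2 * (2 - q)))
      ≤ C * ∫ x : E3, (∑ i : Fin 3, ∑ j : Fin 3, (pd i (Z j) x + pd j (Z i) x) ^ 2)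
            * (max ‖x‖ 1) ^ (-3 + 2 * (3 - q)) := by
  obtain ⟨C, hC0, hC⟩ := main_ineq (3 / 2 - q) (by linarith)
  set m : ℝ := 3 / 2 - q with hm
  refine ⟨2 ^ |m - 1| * (C * 2 ^ |m|) + 2 ^ |m| * (C * 2 ^ |m|), ?_⟩
  intro Z hZ hc
  obtain ⟨hA, hG⟩ := hC Z hZ hc
  have e1 : -3 + 2 * (2 - q) = 2 * (m - 1) := by rw [hm]; ring
  have e2 : -1 + 2 * (2 - q) = 2 * m := by rw [hm]; ring
  have e3 : -3 + 2 * (3 - q) = 2 * m := by rw [hm]; ring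
  rw [e1, e2, e3]
  have cw := fun s => (wtp_contDiff (n := 1) s).continuous
  have cr : ∀ s : ℝ, Continuous (fun x : E3 => (max ‖x‖ 1) ^ s) := fun s =>
    (continuous_norm.max continuous_const).rpow_const fun x =>
      Or.inl (lt_of_lt_of_le one_pos (le_max_right _ _)).ne'
  have cZ := fun j => (hZ j).continuous
  have cP := fun i j => (pd_contDiff (hZ j) i).continuous
  have J1 := int_comp (f := z2 Z) (continuous_finsetSum _ fun j _ => (cZ j).pow 2)
    (cpt hc fun x h _ => by simp [z2, h]) (fun x => by unfold z2; positivity)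
    (cr (2 * (m - 1))) (cw (m - 1)) (fun x => (r_comp x (m - 1)).1)
  have J2 := int_comp (f := g2 Z) (continuous_finsetSum _ fun i _ => continuous_finsetSum _
      fun j _ => (cP i j).pow 2)
    (cpt hc fun x _ h => by simp [g2, h]) (fun x => by unfold g2; positivity)
    (cr (2 * m)) (cw m) (fun x => (r_comp x m).1)
  have J3 := int_comp (f := d2 Z) (continuous_finsetSum _ fun i _ => continuous_finsetSum _
      fun j _ => ((cP i j).add (cP j i)).pow 2)
    (cpt hc fun x _ h => by simp [d2, h]) (fun x => by unfold d2; positivity)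
    (cw m) (cr (2 * m)) (fun x => (r_comp x m).2)
  have J4 := mul_le_mul_of_nonneg_left J3 hC0
  have k1 : (0 : ℝ) ≤ 2 ^ |m - 1| := by positivity
  have k2 : (0 : ℝ) ≤ 2 ^ |m| := by positivity
  have L1 := J1.trans (mul_le_mul_of_nonneg_left (hA.trans J4) k1)
  have L2 := J2.trans (mul_le_mul_of_nonneg_left (hG.trans J4) k2)
  have L := add_le_add L1 L2
  refine L.trans (le_of_eq ?_)
  simp only [d2]
  ring
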